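/- Let H be a finite weakly chordal undirected graph. Then the maximum size of an independent set of H is equal to the minimum number of cliques of H needed to cover all vertices of H. -/

import Mathlib

/-- `c` lists the vertices of an induced cycle of length `n` of `G`, in cyclic order. -/
def IsInducedCycle {V : Type*} (G : SimpleGraph V) (n : ℕ) (c : Fin n → V) : Prop :=
  Function.Injective c ∧
    ∀ i j : Fin n, G.Adj (c i) (c j) ↔ ((i.val + 1) % n = j.val ∨ (j.val + 1) % n = i.val)

/-- A hole: an induced cycle of length at least 5. -/
def HasHole {V : Type*} (G : SimpleGraph V) : Prop :=
  ∃ n, 5 ≤ n ∧ ∃ c : Fin n → V, IsInducedCycle G n c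

/-- An anti-hole: an induced subgraph whose complement is a cycle of length at least 5. -/
def HasAntihole {V : Type*} (G : SimpleGraph V) : Prop :=
  ∃ n, 5 ≤ n ∧ ∃ c : Fin n → V, IsInducedCycle Gᶜ n c

/-- A graph is weakly chordal if it has no hole and no anti-hole. -/
def WeaklyChordal {V : Type*} (G : SimpleGraph V) : Prop :=
  ¬ HasHole G ∧ ¬ HasAntihole G


section helpers
variable {V : Type*}

/-- induced path with vertices `p 0, ..., p k`. -/
def IP (G : SimpleGraph V) (k : ℕ) (p : ℕ → V) : Prop :=
  ∀ i j, i < j → j ≤ k → p i ≠ p j ∧ (G.Adj (p i) (p j) ↔ j = i + 1)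

lemma IP.rev {G : SimpleGraph V} {k : ℕ} {p : ℕ → V} (h : IP G k p) :
    IP G k (fun i => p (k - i)) := by
  intro i j hij hj
  have := h (k - j) (k - i) (by omega) (by omega)
  refine ⟨this.1.symm, ?_⟩
  rw [G.adj_comm, this.2]
  omega

lemma hole_of_path {G : SimpleGraph V} {k : ℕ} {p : ℕ → V} {z : V} (hk : 3 ≤ k)
    (h : IP G k p) (hz : ∀ i, i ≤ k → (G.Adj z (p i) ↔ i = 0 ∨ i = k)) : HasHole G := by
  have hne : ∀ i, i ≤ k → z ≠ p i := by
    intro i hi he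
    have h0 := (hz 0 (by omega)).2 (Or.inl rfl)
    have h1 := (hz k le_rfl).2 (Or.inr rfl)
    rw [he] at h0 h1
    have hi0 : 0 < i := by
      rcases Nat.eq_zero_or_pos i with rfl | h'
      · exact absurd h0 (G.loopless.irrefl _)
      · exact h'
    have hik : i < k := by
      rcases Nat.lt_or_eq_of_le hi with h' | rfl
      · exact h'
      · exact absurd h1 (G.loopless.irrefl _)
    have e0 := (h 0 i hi0 hi).2.1 h0.symm
    have e1 := (h i k hik le_rfl).2.1 h1
    omega
  refine ⟨k + 2, by omega, fun i => if i.val ≤ k then p i.val else z, ?_, ?_⟩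
  · intro i j hij
    have hi := i.isLt
    have hj := j.isLt
    apply Fin.ext
    dsimp only at hij
    split_ifs at hij with h1 h2 h2
    · rcases lt_trichotomy i.val j.val with h' | h' | h'
      · exact absurd hij (h _ _ h' h2).1
      · exact h'
      · exact absurd hij.symm (h _ _ h' h1).1
    · exact absurd hij.symm (hne _ h1)
    · exact absurd hij (hne _ h2)
    · omega
  · intro i j
    have hi := i.isLt
    have hj := j.isLt
    have key : ∀ m, m < k + 2 → (m + 1) % (k + 2) = if m = k + 1 then 0 else m + 1 := by
      intro m hm
      split_ifs with h'
      · subst h'; simp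
      · exact Nat.mod_eq_of_lt (by omega)
    rw [key _ hi, key _ hj]
    dsimp only
    split_ifs <;> first | omega | skip
    all_goals first
      | (rw [hz _ (by omega)]; omega)
      | (rw [G.adj_comm, hz _ (by omega)]; omega)
      | (simp; omega)
      | (rcases lt_trichotomy i.val j.val with h' | h' | h'
         · rw [(h _ _ h' (by omega)).2]; omega
         · rw [h']; simp
         · rw [G.adj_comm, (h _ _ h' (by omega)).2]; omega)

lemma path_of_cycle {G : SimpleGraph V} {n : ℕ} {c : Fin n → V} (hn : 5 ≤ n)
    (h : IsInducedCycle G n c) (i0 : Fin n) :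
    ∃ k p, 3 ≤ k ∧ IP G k p ∧ (∀ i, i ≤ k → (G.Adj (c i0) (p i) ↔ i = 0 ∨ i = k)) ∧
      (∀ i, i ≤ k → c i0 ≠ p i) := by
  have h0 := i0.isLt
  have key : ∀ m, m < 2 * n → m % n = if m < n then m else m - n := by
    intro m hm
    split_ifs with h'
    · exact Nat.mod_eq_of_lt h'
    · rw [Nat.mod_eq_sub_mod (by omega)]; exact Nat.mod_eq_of_lt (by omega)
  refine ⟨n - 2, fun i => c ⟨(i0.val + 1 + i) % n, Nat.mod_lt _ (by omega)⟩, by omega,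
    ?_, ?_, ?_⟩
  · intro i j hij hj
    constructor
    · intro he
      have := congrArg Fin.val (h.1 he)
      dsimp only at this
      rw [key _ (by omega), key _ (by omega)] at this
      split_ifs at this <;> omega
    · rw [h.2]
      dsimp only
      rw [key (i0.val + 1 + i) (by omega), key (i0.val + 1 + j) (by omega)]
      split_ifs
      all_goals
        rw [key _ (by omega), key _ (by omega)]
        split_ifs <;> omega
  · intro i hi
    rw [h.2]
    dsimp only
    rw [key (i0.val + 1 + i) (by omega)]
    split_ifs
    all_goals
      rw [key _ (by omega), key _ (by omega)]
      split_ifs <;> omega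
  · intro i hi he
    have := congrArg Fin.val (h.1 he)
    dsimp only at this
    rw [key _ (by omega)] at this
    split_ifs at this <;> omega

/-- step inside a set -/
def StepIn (G : SimpleGraph V) (W : Set V) (u v : V) : Prop := G.Adj u v ∧ u ∈ W ∧ v ∈ W

def ConnSet (G : SimpleGraph V) (W : Set V) : Prop :=
  ∀ a ∈ W, ∀ b ∈ W, Relation.ReflTransGen (StepIn G W) a b

lemma conn_mono {G : SimpleGraph V} {W W' : Set V} (h : W ⊆ W') {a b : V}
    (hab : Relation.ReflTransGen (StepIn G W) a b) :
    Relation.ReflTransGen (StepIn G W') a b :=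
  Relation.ReflTransGen.mono (fun _ _ h' => ⟨h'.1, h h'.2.1, h h'.2.2⟩) _ _ hab

lemma conn_insert {G : SimpleGraph V} {W : Set V} (h : ConnSet G W) {v t : V} (ht : t ∈ W)
    (hv : G.Adj v t) : ConnSet G (insert v W) := by
  have sub : W ⊆ insert v W := Set.subset_insert _ _
  have h1 : StepIn G (insert v W) v t := ⟨hv, Or.inl rfl, sub ht⟩
  have h2 : StepIn G (insert v W) t v := ⟨hv.symm, sub ht, Or.inl rfl⟩
  rintro a (rfl | ha) b (rfl | hb)
  · exact .refl
  · exact (Relation.ReflTransGen.single h1).trans (conn_mono sub (h _ ht _ hb))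
  · exact (conn_mono sub (h _ ha _ ht)).trans (.single h2)
  · exact conn_mono sub (h _ ha _ hb)

def Chn (G : SimpleGraph V) (W : Set V) (a b : V) (k : ℕ) (p : ℕ → V) : Prop :=
  p 0 = a ∧ p k = b ∧ (∀ i, i < k → G.Adj (p i) (p (i + 1))) ∧ ∀ i, i ≤ k → p i ∈ W

lemma exists_chn {G : SimpleGraph V} {W : Set V} {a b : V} (ha : a ∈ W)
    (h : Relation.ReflTransGen (StepIn G W) a b) : ∃ k p, Chn G W a b k p := by
  induction h with
  | refl => exact ⟨0, fun _ => a, rfl, rfl, by simp, fun _ _ => ha⟩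
  | @tail b c _ hs ih =>
    obtain ⟨k, p, h0, hk, h1, h2⟩ := ih
    refine ⟨k + 1, fun i => if i ≤ k then p i else c, by simpa using h0, by simp, ?_, ?_⟩
    · intro i hi
      rcases Nat.lt_or_eq_of_le (Nat.lt_succ_iff.1 hi) with h' | rfl
      · simpa [h'.le, Nat.succ_le_of_lt h'] using h1 i h'
      · simpa [hk] using hs.1
    · intro i hi
      dsimp only
      split_ifs with h'
      · exact h2 i h'
      · exact hs.2.2

lemma exists_ip {G : SimpleGraph V} {W : Set V} {a b : V} (ha : a ∈ W)
    (h : Relation.ReflTransGen (StepIn G W) a b) :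
    ∃ k p, IP G k p ∧ p 0 = a ∧ p k = b ∧ ∀ i, i ≤ k → p i ∈ W := by
  classical
  have hex := exists_chn ha h
  obtain ⟨p, hp⟩ := Nat.find_spec hex
  have hmin : ∀ m, m < Nat.find hex → ∀ q, ¬ Chn G W a b m q := fun m hm q hq =>
    Nat.find_min hex hm ⟨q, hq⟩
  generalize Nat.find hex = k at hp hmin
  obtain ⟨h0, hk, h1, h2⟩ := hp
  refine ⟨k, p, ?_, h0, hk, h2⟩
  intro i j hij hj
  -- shortcut
  have sc : ∀ d, 0 < d → i + d ≤ k → (i + d = k → p i = b) →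
      (i + d < k → G.Adj (p i) (p (i + d + 1))) → False := by
    intro d hd hdk he ha
    refine hmin (k - d) (by omega) (fun n => if n ≤ i then p n else p (n + d)) ⟨?_, ?_, ?_, ?_⟩
    · simpa using h0
    · dsimp only
      split_ifs with h'
      · have : k - d = i := by omega
        rw [this]; exact he (by omega)
      · rw [Nat.sub_add_cancel (by omega)]; exact hk
    · intro n hn
      dsimp only
      split_ifs with h3 h4 h4
      · exact h1 n (by omega)
      · have : n = i := by omega
        subst this
        have := ha (by omega)
        rwa [show n + 1 + d = n + d + 1 by omega]
      · omega
      · have := h1 (n + d) (by omega)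
        rwa [show n + 1 + d = n + d + 1 by omega]
    · intro n hn
      dsimp only
      split_ifs
      · exact h2 n (by omega)
      · exact h2 _ (by omega)
  have hne : p i ≠ p j := by
    intro he
    refine sc (j - i) (by omega) (by omega) ?_ ?_
    · intro h'
      rw [he, show j = k by omega, hk]
    · intro h'
      rw [he, show i + (j - i) + 1 = j + 1 by omega]
      exact h1 j (by omega)
  refine ⟨hne, ?_, ?_⟩
  · intro hadj
    by_contra hc
    refine sc (j - i - 1) (by omega) (by omega) ?_ ?_
    · intro h'; omega
    · intro h'
      rwa [show i + (j - i - 1) + 1 = j by omega]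
  · rintro rfl
    exact h1 i (by omega)

lemma compl_adj' {G : SimpleGraph V} {a b : V} : Gᶜ.Adj a b ↔ a ≠ b ∧ ¬ G.Adj a b :=
  SimpleGraph.compl_adj G a b

lemma key_path {G : SimpleGraph V} (hG : WeaklyChordal G) {T : Set V} (hT : ConnSet Gᶜ T)
    {k : ℕ} {p : ℕ → V} (hk : 3 ≤ k) (hp : IP G k p)
    (h0 : ∀ t ∈ T, G.Adj (p 0) t) (hkT : ∀ t ∈ T, G.Adj (p k) t)
    (h1 : ∃ t ∈ T, ¬ G.Adj (p 1) t) (h2 : ∃ t ∈ T, ¬ G.Adj (p 2) t) : False := by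
  have n1 : p 1 ∉ T := fun h => by
    have := (hp 1 k (by omega) le_rfl).2.1 (hkT _ h).symm
    omega
  have n2 : p 2 ∉ T := fun h => by
    have := (hp 0 2 (by omega) (by omega)).2.1 (h0 _ h)
    omega
  obtain ⟨t1, ht1, h1⟩ := h1
  obtain ⟨t2, ht2, h2⟩ := h2
  have a1 : Gᶜ.Adj (p 1) t1 := compl_adj'.2 ⟨fun h => n1 (h ▸ ht1), h1⟩
  have a2 : Gᶜ.Adj (p 2) t2 := compl_adj'.2 ⟨fun h => n2 (h ▸ ht2), h2⟩
  have hc := conn_insert (conn_insert hT ht1 a1) (Or.inr ht2) a2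
  obtain ⟨m, q, hq, hq0, hqm, hqW⟩ := exists_ip (by simp) (hc (p 1) (by simp) (p 2) (by simp))
  have hint : ∀ i, 0 < i → i < m → q i ∈ T := by
    intro i hi him
    rcases hqW i him.le with h | h | h
    · exact absurd (h.trans hqm.symm) (hq i m him le_rfl).1
    · exact absurd (h.trans hq0.symm).symm (hq 0 i hi him.le).1
    · exact h
  have ad12 : G.Adj (p 1) (p 2) := (hp 1 2 (by omega) (by omega)).2.2 rfl
  have m0 : m ≠ 0 := by
    rintro rfl
    exact G.ne_of_adj ad12 (hq0.symm.trans hqm)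
  have m1 : m ≠ 1 := by
    rintro rfl
    have := (hq 0 1 (by omega) le_rfl).2.2 rfl
    rw [hq0, hqm, compl_adj'] at this
    exact this.2 ad12
  by_cases m2 : m = 2
  · subst m2
    have hs := hint 1 (by omega) (by omega)
    have b1 := (hq 0 1 (by omega) (by omega)).2.2 rfl
    have b2 := (hq 1 2 (by omega) (by omega)).2.2 rfl
    rw [hq0, compl_adj'] at b1
    rw [hqm, compl_adj'] at b2
    generalize q 1 = s at hs b1 b2
    classical
    have hex : ∃ j, 3 ≤ j ∧ j ≤ k ∧ G.Adj (p j) s := ⟨k, hk, le_rfl, hkT _ hs⟩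
    obtain ⟨c1, c2, c3⟩ := Nat.find_spec hex
    have hmin : ∀ i, i < Nat.find hex → ¬ _ := fun i hi => Nat.find_min hex hi
    generalize Nat.find hex = j at c1 c2 c3 hmin
    apply hG.1
    refine hole_of_path (z := s) c1 (fun i i' h h' => hp i i' h (by omega)) ?_
    intro i hi
    constructor
    · intro ha
      by_contra hcon
      have : i ≠ 1 := by rintro rfl; exact b1.2 ha.symm
      have : i ≠ 2 := by rintro rfl; exact b2.2 ha
      exact hmin i (by omega) ⟨by omega, by omega, ha.symm⟩
    · rintro (rfl | rfl)
      · exact (h0 _ hs).symm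
      · exact c3.symm
  · have hm : 3 ≤ m := by omega
    apply hG.2
    by_cases hk3 : k = 3
    · subst hk3
      have f : ∀ i j, i < j → j ≤ 3 → (Gᶜ.Adj (p i) (p j) ↔ j ≠ i + 1) := by
        intro i j hij hj
        have := hp i j hij hj
        rw [compl_adj', this.2]
        simp [this.1]
      refine hole_of_path (G := Gᶜ) (k := m + 1) (p := fun i => if i ≤ m then q i else p 0)
        (z := p 3) (by omega) ?_ ?_
      · intro i j hij hj
        by_cases hjm : j ≤ m
        · simpa [hjm, hij.le.trans hjm] using hq i j hij hjm
        · have hj' : j = m + 1 := by omega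
          subst hj'
          have him : i ≤ m := by omega
          simp only [him, if_true, hjm, if_false]
          by_cases e0 : i = 0
          · subst e0
            rw [hq0]
            refine ⟨(hp 0 1 (by omega) (by omega)).1.symm, ?_⟩
            rw [SimpleGraph.adj_comm, f 0 1 (by omega) (by omega)]
            omega
          · by_cases em : i = m
            · subst em
              rw [hqm]
              refine ⟨(hp 0 2 (by omega) (by omega)).1.symm, ?_⟩
              rw [SimpleGraph.adj_comm, f 0 2 (by omega) (by omega)]
              omega
            · have := h0 _ (hint i (by omega) (by omega))
              refine ⟨this.ne', ?_⟩
              rw [compl_adj']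
              constructor
              · intro h; exact absurd this.symm h.2
              · intro h; omega
      · intro i hi
        split_ifs with him
        · by_cases e0 : i = 0
          · subst e0
            rw [hq0, SimpleGraph.adj_comm, f 1 3 (by omega) (by omega)]
            omega
          · by_cases em : i = m
            · subst em
              rw [hqm, SimpleGraph.adj_comm, f 2 3 (by omega) (by omega)]
              omega
            · have := hkT _ (hint i (by omega) (by omega))
              rw [compl_adj']
              constructor
              · intro h; exact absurd this h.2
              · intro h; omega
        · rw [SimpleGraph.adj_comm, f 0 3 (by omega) (by omega)]
          omega
    · refine hole_of_path (G := Gᶜ) (z := p k) hm hq ?_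
      intro i hi
      by_cases e0 : i = 0
      · subst e0
        have := hp 1 k (by omega) le_rfl
        rw [hq0, SimpleGraph.adj_comm, compl_adj', this.2]
        simp [this.1]; omega
      · by_cases em : i = m
        · subst em
          have := hp 2 k (by omega) le_rfl
          rw [hqm, SimpleGraph.adj_comm, compl_adj', this.2]
          simp [this.1]; omega
        · have := hkT _ (hint i (by omega) (by omega))
          rw [compl_adj']
          constructor
          · intro h; exact absurd this h.2
          · intro h; omega

/-- two-pair inside `S` -/
def TP (G : SimpleGraph V) (S : Set V) (x y : V) : Prop :=
  x ∈ S ∧ y ∈ S ∧ x ≠ y ∧ ¬ G.Adj x y ∧ ∀ k p, 3 ≤ k → IP G k p → (∀ i, i ≤ k → p i ∈ S) →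
    p 0 = x → p k = y → False

lemma TP.symm {G : SimpleGraph V} {S : Set V} {x y : V} (h : TP G S x y) : TP G S y x := by
  obtain ⟨h1, h2, h3, h4, h5⟩ := h
  refine ⟨h2, h1, h3.symm, fun h => h4 h.symm, ?_⟩
  intro k p hk hp hS h0 hk'
  exact h5 k _ hk hp.rev (fun i _ => hS _ (by omega)) (by simpa using hk') (by simpa using h0)

lemma exists_TP [Fintype V] {G : SimpleGraph V} (hG : WeaklyChordal G) (n : ℕ) :
    ∀ S : Finset V, S.card = n → (∃ a ∈ S, ∃ b ∈ S, a ≠ b ∧ ¬ G.Adj a b) →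
      ∃ x y, TP G (S : Set V) x y := by
  classical
  induction n using Nat.strong_induction_on with
  | _ n ih =>
  intro S hS hne
  let good : Finset V → Prop := fun T => T ⊆ S ∧ T.Nonempty ∧ ConnSet Gᶜ (T : Set V) ∧
    ∃ a ∈ S, ∃ b ∈ S, a ≠ b ∧ ¬ G.Adj a b ∧ (∀ t ∈ T, G.Adj a t) ∧ ∀ t ∈ T, G.Adj b t
  by_cases hgood : ∃ T, good T
  · obtain ⟨T, hT, hmax⟩ := Finset.exists_max_image (Finset.univ.filter good) Finset.card
      (by obtain ⟨T, hT⟩ := hgood; exact ⟨T, by simpa using hT⟩)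
    have hT : good T := by simpa using hT
    have hmax : ∀ T', good T' → T'.card ≤ T.card := fun T' h => hmax T' (by simpa using h)
    obtain ⟨hTS, ⟨t0, ht0⟩, hTc, a, ha, b, hb, hab, hnab, haT, hbT⟩ := hT
    let C := S.filter (fun v => ∀ t ∈ T, G.Adj v t)
    have hCS : C ⊂ S := by
      refine Finset.filter_ssubset.2 ⟨t0, hTS ht0, ?_⟩
      intro h
      exact G.loopless.irrefl _ (h t0 ht0)
    have memC : ∀ v, v ∈ C ↔ v ∈ S ∧ ∀ t ∈ T, G.Adj v t := fun v => by simp [C]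
    obtain ⟨x, y, hx, hy, hxy, hnxy, hpath⟩ := ih C.card (hS ▸ Finset.card_lt_card hCS) C rfl
      ⟨a, (memC a).2 ⟨ha, haT⟩, b, (memC b).2 ⟨hb, hbT⟩, hab, hnab⟩
    refine ⟨x, y, hCS.1 hx, hCS.1 hy, hxy, hnxy, ?_⟩
    intro k p hk hp hpS h0 hk'
    have hx' := (memC x).1 hx
    have hy' := (memC y).1 hy
    refine hpath k p hk hp ?_ h0 hk'
    by_contra hcon
    push Not at hcon
    obtain ⟨⟨hik, hiC⟩, hmin⟩ := And.intro (Nat.find_spec hcon) (fun i hi => Nat.find_min hcon (m := i) hi)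
    generalize Nat.find hcon = i at hik hiC hmin
    have hiC : p i ∉ C := hiC
    have hi0 : i ≠ 0 := by
      rintro rfl
      exact hiC (h0 ▸ hx)
    have hikk : i ≠ k := by
      rintro rfl
      exact hiC (hk' ▸ hy)
    have hprev : p (i - 1) ∈ C := by
      by_contra h
      exact hmin (i - 1) (by omega) ⟨by omega, h⟩
    have hiT : p i ∉ T := by
      intro h
      have e1 := (hp 0 i (by omega) (by omega)).2.1 (h0 ▸ hx'.2 _ h)
      have e2 := (hp i k (by omega) (by omega)).2.1 (hk' ▸ hy'.2 _ h).symm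
      omega
    have hiS : p i ∈ S := hpS i hik
    have hex : ∀ j, j ≤ k → p j ∉ C → ∃ t ∈ T, ¬ G.Adj (p j) t := by
      intro j hj hjC
      by_contra h
      push Not at h
      exact hjC ((memC _).2 ⟨hpS j hj, h⟩)
    by_cases hnext : p (i + 1) ∈ C
    · obtain ⟨t, ht, hnt⟩ := hex i hik hiC
      have : good (insert (p i) T) := by
        refine ⟨Finset.insert_subset hiS hTS, ⟨p i, by simp⟩, ?_, p (i - 1), hCS.1 hprev,
          p (i + 1), hCS.1 hnext, ?_, ?_, ?_, ?_⟩
        · rw [Finset.coe_insert]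
          exact conn_insert hTc ht (compl_adj'.2 ⟨fun h => hiT (h ▸ ht), hnt⟩)
        · exact (hp _ _ (by omega) (by omega)).1
        · rw [(hp _ _ (by omega) (by omega)).2]; omega
        · intro t ht
          rcases Finset.mem_insert.1 ht with rfl | ht
          · rw [(hp _ _ (by omega) (by omega)).2]; omega
          · exact ((memC _).1 hprev).2 t ht
        · intro t ht
          rcases Finset.mem_insert.1 ht with rfl | ht
          · rw [G.adj_comm, (hp _ _ (by omega) (by omega)).2]
          · exact ((memC _).1 hnext).2 t ht
      have := hmax _ this
      rw [Finset.card_insert_of_notMem hiT] at this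
      omega
    · have hi1 : i + 1 ≠ k := by
        intro h
        rw [h, hk'] at hnext
        exact hnext hy
      refine key_path hG hTc (k := k - (i - 1)) (p := fun j => p (i - 1 + j)) (by omega) ?_ ?_ ?_ ?_ ?_
      · intro j j' hj hj'
        have := hp (i - 1 + j) (i - 1 + j') (by omega) (by omega)
        refine ⟨this.1, this.2.trans ?_⟩
        omega
      · exact ((memC _).1 hprev).2
      · rw [show i - 1 + (k - (i - 1)) = k by omega, hk']
        exact hy'.2
      · rw [show i - 1 + 1 = i by omega]
        exact hex i hik hiC
      · rw [show i - 1 + 2 = i + 1 by omega]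
        exact hex (i + 1) (by omega) hnext
  · obtain ⟨a, ha, b, hb, hab, hnab⟩ := hne
    refine ⟨a, b, ha, hb, hab, hnab, ?_⟩
    intro k p hk hp hpS h0 hk'
    apply hgood
    refine ⟨{p 1}, ?_, by simp, ?_, p 0, hpS 0 (by omega), p 2, hpS 2 (by omega), ?_, ?_, ?_, ?_⟩
    · simpa using hpS 1 (by omega)
    · intro a ha b hb
      simp only [Finset.coe_singleton, Set.mem_singleton_iff] at ha hb
      rw [ha, hb]
    · exact (hp 0 2 (by omega) (by omega)).1
    · rw [(hp 0 2 (by omega) (by omega)).2]; omega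
    · simpa using (hp 0 1 (by omega) (by omega)).2
    · simpa [G.adj_comm] using (hp 1 2 (by omega) (by omega)).2



/-- contraction of the pair `x, y` -/
def Ctr (G : SimpleGraph V) (x y : V) : SimpleGraph {v : V // v ≠ y} where
  Adj u v := u ≠ v ∧ (G.Adj u v ∨ (u.1 = x ∧ G.Adj y v) ∨ (v.1 = x ∧ G.Adj y u))
  symm := ⟨by
    rintro u v ⟨h, h'⟩
    refine ⟨h.symm, ?_⟩
    rcases h' with h' | h' | h'
    · exact Or.inl h'.symm
    · exact Or.inr (Or.inr h')
    · exact Or.inr (Or.inl h')⟩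
  loopless := ⟨fun u h => h.1 rfl⟩

lemma ctr_adj_of_ne {G : SimpleGraph V} {x y : V} {u v : {v : V // v ≠ y}}
    (hu : u.1 ≠ x) (hv : v.1 ≠ x) : (Ctr G x y).Adj u v ↔ G.Adj u v := by
  simp only [Ctr, hu, hv, false_and, or_false]
  exact ⟨fun h => h.2, fun h => ⟨fun e => G.ne_of_adj h (congrArg _ e), h⟩⟩

lemma ctr_adj_left {G : SimpleGraph V} {x y : V} {u v : {v : V // v ≠ y}}
    (hu : u.1 = x) (hv : v.1 ≠ x) : (Ctr G x y).Adj u v ↔ G.Adj x v ∨ G.Adj y v := by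
  simp only [Ctr, hu, hv, false_and, or_false, true_and]
  exact ⟨fun h => h.2, fun h => ⟨fun e => hv (e ▸ hu), h⟩⟩

lemma ip3 {G : SimpleGraph V} {a b c d : V} (h1 : G.Adj a b) (h2 : G.Adj b c) (h3 : G.Adj c d)
    (n1 : a ≠ c) (n2 : a ≠ d) (n3 : b ≠ d) (m1 : ¬ G.Adj a c) (m2 : ¬ G.Adj a d)
    (m3 : ¬ G.Adj b d) :
    IP G 3 (fun n => if n = 0 then a else if n = 1 then b else if n = 2 then c else d) := by
  intro i j hij hj
  have := h1.ne
  have := h2.ne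
  have := h3.ne
  interval_cases j <;> interval_cases i <;> simp_all

lemma ip4 {G : SimpleGraph V} {a b c d e : V} (h1 : G.Adj a b) (h2 : G.Adj b c) (h3 : G.Adj c d)
    (h4 : G.Adj d e)
    (n1 : a ≠ c) (n2 : a ≠ d) (n3 : b ≠ d) (n4 : a ≠ e) (n5 : b ≠ e) (n6 : c ≠ e)
    (m1 : ¬ G.Adj a c) (m2 : ¬ G.Adj a d) (m3 : ¬ G.Adj b d)
    (m4 : ¬ G.Adj a e) (m5 : ¬ G.Adj b e) (m6 : ¬ G.Adj c e) :
    IP G 4 (fun n => if n = 0 then a else if n = 1 then b else if n = 2 then c else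
      if n = 3 then d else e) := by
  intro i j hij hj
  have := h1.ne
  have := h2.ne
  have := h3.ne
  have := h4.ne
  interval_cases j <;> interval_cases i <;> simp_all

lemma ip5 {G : SimpleGraph V} {a b c d e f : V} (h1 : G.Adj a b) (h2 : G.Adj b c)
    (h3 : G.Adj c d) (h4 : G.Adj d e) (h5 : G.Adj e f)
    (n1 : a ≠ c) (n2 : a ≠ d) (n3 : b ≠ d) (n4 : a ≠ e) (n5 : b ≠ e) (n6 : c ≠ e)
    (n7 : a ≠ f) (n8 : b ≠ f) (n9 : c ≠ f) (n10 : d ≠ f)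
    (m1 : ¬ G.Adj a c) (m2 : ¬ G.Adj a d) (m3 : ¬ G.Adj b d)
    (m4 : ¬ G.Adj a e) (m5 : ¬ G.Adj b e) (m6 : ¬ G.Adj c e)
    (m7 : ¬ G.Adj a f) (m8 : ¬ G.Adj b f) (m9 : ¬ G.Adj c f) (m10 : ¬ G.Adj d f) :
    IP G 5 (fun n => if n = 0 then a else if n = 1 then b else if n = 2 then c else
      if n = 3 then d else if n = 4 then e else f) := by
  intro i j hij hj
  have := h1.ne
  have := h2.ne
  have := h3.ne
  have := h4.ne
  have := h5.ne
  interval_cases j <;> interval_cases i <;> simp_all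

lemma TP.no_path {G : SimpleGraph V} {x y : V} (h : TP G Set.univ x y) {k : ℕ} {p : ℕ → V}
    (hk : 3 ≤ k) (hp : IP G k p) (h0 : p 0 = x) (h1 : p k = y) : False :=
  h.2.2.2.2 k p hk hp (fun _ _ => trivial) h0 h1

lemma no_hole_aux {G : SimpleGraph V} {x y : V} (h : TP G Set.univ x y) {k : ℕ} {p : ℕ → V}
    (hk : 3 ≤ k) (hp : IP G k p) (hx : ∀ i, i ≤ k → x ≠ p i) (hy : ∀ i, i ≤ k → y ≠ p i)
    (hadj : ∀ i, i ≤ k → (G.Adj x (p i) ∨ G.Adj y (p i) ↔ i = 0 ∨ i = k))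
    (h0 : G.Adj x (p 0)) (h1 : G.Adj y (p k)) (h2 : ¬ G.Adj x (p k)) (h3 : ¬ G.Adj y (p 0)) :
    False := by
  refine h.no_path (k := k + 2)
    (p := fun n => if n = 0 then x else if n ≤ k + 1 then p (n - 1) else y)
    (by omega) ?_ (by simp) (by simp)
  obtain ⟨-, -, hxy, hnxy, -⟩ := h
  have hx' : ∀ i, i ≤ k → (G.Adj x (p i) ↔ i = 0) := by
    intro i hi
    constructor
    · intro ha
      rcases (hadj i hi).1 (Or.inl ha) with h | rfl
      · exact h
      · exact absurd ha h2
    · rintro rfl; exact h0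
  have hy' : ∀ i, i ≤ k → (G.Adj y (p i) ↔ i = k) := by
    intro i hi
    constructor
    · intro ha
      rcases (hadj i hi).1 (Or.inr ha) with rfl | h
      · exact absurd ha h3
      · exact h
    · rintro rfl; exact h1
  intro i j hij hj
  have hj0 : j ≠ 0 := by omega
  dsimp only
  rw [if_neg hj0]
  split_ifs with c1 c2 c2 c3
  · refine ⟨hx _ (by omega), ?_⟩
    rw [hx' _ (by omega)]; omega
  · refine ⟨hxy, ?_⟩
    constructor
    · intro h; exact absurd h hnxy
    · intro h; omega
  · have := hp (i - 1) (j - 1) (by omega) (by omega)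
    refine ⟨this.1, ?_⟩
    rw [this.2]; omega
  · refine ⟨(hy _ (by omega)).symm, ?_⟩
    rw [G.adj_comm, hy' _ (by omega)]; omega
  · omega
  · omega

lemma no_hole {G : SimpleGraph V} (hG : WeaklyChordal G) {x y : V} (h : TP G Set.univ x y)
    {k : ℕ} {p : ℕ → V}
    (hk : 3 ≤ k) (hp : IP G k p) (hx : ∀ i, i ≤ k → x ≠ p i) (hy : ∀ i, i ≤ k → y ≠ p i)
    (hadj : ∀ i, i ≤ k → (G.Adj x (p i) ∨ G.Adj y (p i) ↔ i = 0 ∨ i = k)) : False := by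
  by_cases x0 : G.Adj x (p 0) <;> by_cases xk : G.Adj x (p k)
  · refine hG.1 (hole_of_path (z := x) hk hp fun i hi => ⟨fun ha => (hadj i hi).1 (Or.inl ha), ?_⟩)
    rintro (rfl | rfl) <;> assumption
  · have yk : G.Adj y (p k) := ((hadj k le_rfl).2 (Or.inr rfl)).resolve_left xk
    by_cases y0 : G.Adj y (p 0)
    · refine hG.1 (hole_of_path (z := y) hk hp
        fun i hi => ⟨fun ha => (hadj i hi).1 (Or.inr ha), ?_⟩)
      rintro (rfl | rfl) <;> assumption
    · exact no_hole_aux h hk hp hx hy hadj x0 yk xk y0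
  · have y0 : G.Adj y (p 0) := ((hadj 0 (by omega)).2 (Or.inl rfl)).resolve_left x0
    by_cases yk : G.Adj y (p k)
    · refine hG.1 (hole_of_path (z := y) hk hp
        fun i hi => ⟨fun ha => (hadj i hi).1 (Or.inr ha), ?_⟩)
      rintro (rfl | rfl) <;> assumption
    · exact no_hole_aux h.symm hk hp hy hx (fun i hi => or_comm.trans (hadj i hi)) y0 xk yk x0
  · have y0 : G.Adj y (p 0) := ((hadj 0 (by omega)).2 (Or.inl rfl)).resolve_left x0
    have yk : G.Adj y (p k) := ((hadj k le_rfl).2 (Or.inr rfl)).resolve_left xk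
    refine hG.1 (hole_of_path (z := y) hk hp
      fun i hi => ⟨fun ha => (hadj i hi).1 (Or.inr ha), ?_⟩)
    rintro (rfl | rfl) <;> assumption

/-- `p` is an induced path of the complement -/
lemma no_antihole {G : SimpleGraph V} (hG : WeaklyChordal G) {x y : V} (h : TP G Set.univ x y)
    {k : ℕ} {p : ℕ → V}
    (hk : 3 ≤ k) (hp : IP Gᶜ k p) (hx : ∀ i, i ≤ k → x ≠ p i) (hy : ∀ i, i ≤ k → y ≠ p i)
    (hadj : ∀ i, i ≤ k → (¬ (G.Adj x (p i) ∨ G.Adj y (p i)) ↔ i = 0 ∨ i = k)) : False := by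
  obtain ⟨-, -, hxy, hnxy, -⟩ := id h
  have end0 := (hadj 0 (by omega)).2 (Or.inl rfl)
  have endk := (hadj k le_rfl).2 (Or.inr rfl)
  push Not at end0 endk
  have x1 : ∃ i, 0 < i ∧ i < k ∧ ¬ G.Adj x (p i) := by
    by_contra hc
    push Not at hc
    refine hG.2 (hole_of_path (G := Gᶜ) (z := x) hk hp fun i hi => ?_)
    rw [compl_adj']
    constructor
    · intro h
      by_contra hc'
      exact h.2 (hc i (by omega) (by omega))
    · rintro (rfl | rfl)
      · exact ⟨hx _ hi, end0.1⟩
      · exact ⟨hx _ hi, endk.1⟩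
  have y1 : ∃ i, 0 < i ∧ i < k ∧ ¬ G.Adj y (p i) := by
    by_contra hc
    push Not at hc
    refine hG.2 (hole_of_path (G := Gᶜ) (z := y) hk hp fun i hi => ?_)
    rw [compl_adj']
    constructor
    · intro h
      by_contra hc'
      exact h.2 (hc i (by omega) (by omega))
    · rintro (rfl | rfl)
      · exact ⟨hy _ hi, end0.2⟩
      · exact ⟨hy _ hi, endk.2⟩
  obtain ⟨i, hi0, hik, hxi⟩ := x1
  obtain ⟨j, hj0, hjk, hyj⟩ := y1
  have hyi : G.Adj y (p i) := by
    by_contra hc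
    have := (hadj i hik.le).1 (by tauto)
    omega
  have hxj : G.Adj x (p j) := by
    by_contra hc
    have := (hadj j hjk.le).1 (by tauto)
    omega
  have hG' : ∀ a b, a < b → b ≤ k → (G.Adj (p a) (p b) ↔ b ≠ a + 1) := by
    intro a b hab hb
    have := hp a b hab hb
    rw [compl_adj'] at this
    rw [← not_iff_not, not_not, ← this.2]
    simp [this.1]
  have hG2 : ∀ a b, a ≠ b → a ≤ k → b ≤ k → (G.Adj (p a) (p b) ↔ b ≠ a + 1 ∧ a ≠ b + 1) := by
    intro a b hab ha hb
    rcases Nat.lt_or_gt_of_ne hab with h' | h'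
    · rw [hG' a b h' hb]; omega
    · rw [G.adj_comm, hG' b a h' ha]; omega
  have hinj : ∀ a b, a ≠ b → a ≤ k → b ≤ k → p a ≠ p b := by
    intro a b hab ha hb
    rcases Nat.lt_or_gt_of_ne hab with h' | h'
    · exact (hp a b h' hb).1
    · exact (hp b a h' ha).1.symm
  have hij : i ≠ j := by
    rintro rfl
    exact hxi hxj
  by_cases hfar : j ≠ i + 1 ∧ i ≠ j + 1
  · exact h.no_path le_rfl (ip3 hxj ((hG2 j i hij.symm hjk.le hik.le).2 ⟨hfar.2, hfar.1⟩)
      hyi.symm (hx i hik.le) hxy (hy j hjk.le).symm hxi hnxy (fun h => hyj h.symm))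
      (by simp) (by simp)
  have hnij : ¬ G.Adj (p j) (p i) := by
    rw [hG2 j i hij.symm hjk.le hik.le]; tauto
  -- a vertex complete to both
  have four : ∀ c, c ≤ k → c ≠ i → c ≠ j → ¬ G.Adj x (p c) → ¬ G.Adj y (p c) →
      G.Adj (p j) (p c) → G.Adj (p c) (p i) → False := by
    intro c hc hci hcj n1 n2 a1 a2
    exact h.no_path (by norm_num) (ip4 hxj a1 a2 hyi.symm (hx c hc) (hx i hik.le)
      (hinj j i hij.symm hjk.le hik.le) hxy (hy j hjk.le).symm (hy c hc).symm n1 hxi hnij hnxy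
      (fun h => hyj h.symm) (fun h => n2 h.symm)) (by simp) (by simp)
  by_cases c1 : 2 ≤ i ∧ 2 ≤ j
  · exact four 0 (by omega) (by omega) (by omega) end0.1 end0.2
      ((hG2 _ _ (by omega) (by omega) (by omega)).2 (by omega))
      ((hG2 _ _ (by omega) (by omega) (by omega)).2 (by omega))
  by_cases c2 : i + 2 ≤ k ∧ j + 2 ≤ k
  · exact four k (by omega) (by omega) (by omega) endk.1 endk.2
      ((hG2 _ _ (by omega) (by omega) (by omega)).2 (by omega))
      ((hG2 _ _ (by omega) (by omega) (by omega)).2 (by omega))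
  have hk3 : k = 3 := by omega
  subst hk3
  have d1 : G.Adj (p 1) (p 3) := (hG2 1 3 (by omega) (by omega) (by omega)).2 (by omega)
  have d2 : G.Adj (p 3) (p 0) := (hG2 3 0 (by omega) (by omega) (by omega)).2 (by omega)
  have d3 : G.Adj (p 0) (p 2) := (hG2 0 2 (by omega) (by omega) (by omega)).2 (by omega)
  have e1 : ¬ G.Adj (p 1) (p 0) := by rw [hG2 _ _ (by omega) (by omega) (by omega)]; omega
  have e2 : ¬ G.Adj (p 1) (p 2) := by rw [hG2 _ _ (by omega) (by omega) (by omega)]; omega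
  have e3 : ¬ G.Adj (p 3) (p 2) := by rw [hG2 _ _ (by omega) (by omega) (by omega)]; omega
  have f1 := hinj 1 0 (by omega) (by omega) (by omega)
  have f2 := hinj 1 2 (by omega) (by omega) (by omega)
  have f3 := hinj 3 2 (by omega) (by omega) (by omega)
  rcases (show (i = 1 ∧ j = 2) ∨ (i = 2 ∧ j = 1) by omega) with ⟨rfl, rfl⟩ | ⟨rfl, rfl⟩
  · exact h.symm.no_path (by norm_num) (ip5 hyi d1 d2 d3 hxj.symm
      (hy 3 (by omega)) (hy 0 (by omega)) f1 (hy 2 (by omega)) f2 f3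
      hxy.symm (hx 1 (by omega)).symm (hx 3 (by omega)).symm (hx 0 (by omega)).symm
      endk.2 end0.2 e1 hyj e2 e3 (fun h => hnxy h.symm) (fun h => hxi h.symm)
      (fun h => endk.1 h.symm) (fun h => end0.1 h.symm)) (by simp) (by simp)
  · exact h.no_path (by norm_num) (ip5 hxj d1 d2 d3 hyi.symm
      (hx 3 (by omega)) (hx 0 (by omega)) f1 (hx 2 (by omega)) f2 f3
      hxy (hy 1 (by omega)).symm (hy 3 (by omega)).symm (hy 0 (by omega)).symm
      endk.1 end0.1 e1 hxi e2 e3 hnxy (fun h => hyj h.symm)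
      (fun h => endk.2 h.symm) (fun h => end0.2 h.symm)) (by simp) (by simp)

lemma ctr_wc {G : SimpleGraph V} (hG : WeaklyChordal G) {x y : V} (h : TP G Set.univ x y) :
    WeaklyChordal (Ctr G x y) := by
  constructor
  · rintro ⟨n, hn, c, hc⟩
    by_cases hx : ∃ i0, (c i0).1 = x
    · obtain ⟨i0, hi0⟩ := hx
      obtain ⟨k, p, hk, hp, hz, hne⟩ := path_of_cycle hn hc i0
      have hpx : ∀ i, i ≤ k → (p i).1 ≠ x := fun i hi e => hne i hi (Subtype.ext (hi0.trans e.symm))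
      refine no_hole hG h hk (p := fun i => (p i).1) ?_ (fun i hi => (hpx i hi).symm)
        (fun i _ => (p i).2.symm) ?_
      · intro i j hij hj
        have := hp i j hij hj
        rw [ctr_adj_of_ne (hpx i (by omega)) (hpx j hj)] at this
        exact ⟨fun e => this.1 (Subtype.ext e), this.2⟩
      · intro i hi
        rw [← hz i hi, ctr_adj_left hi0 (hpx i hi)]
    · push Not at hx
      refine hG.1 ⟨n, hn, fun i => (c i).1, fun i j e => hc.1 (Subtype.ext e), fun i j => ?_⟩
      rw [← hc.2 i j, ctr_adj_of_ne (hx i) (hx j)]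
  · rintro ⟨n, hn, c, hc⟩
    by_cases hx : ∃ i0, (c i0).1 = x
    · obtain ⟨i0, hi0⟩ := hx
      obtain ⟨k, p, hk, hp, hz, hne⟩ := path_of_cycle hn hc i0
      have hpx : ∀ i, i ≤ k → (p i).1 ≠ x := fun i hi e => hne i hi (Subtype.ext (hi0.trans e.symm))
      refine no_antihole hG h hk (p := fun i => (p i).1) ?_ (fun i hi => (hpx i hi).symm)
        (fun i _ => (p i).2.symm) ?_
      · intro i j hij hj
        have := hp i j hij hj
        rw [compl_adj', ctr_adj_of_ne (hpx i (by omega)) (hpx j hj)] at this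
        refine ⟨fun e => this.1 (Subtype.ext e), ?_⟩
        rw [← this.2, compl_adj', Ne, Ne, Subtype.ext_iff]
      · intro i hi
        rw [← hz i hi, compl_adj', ctr_adj_left hi0 (hpx i hi)]
        exact ⟨fun h => ⟨hne i hi, h⟩, fun h => h.2⟩
    · push Not at hx
      refine hG.2 ⟨n, hn, fun i => (c i).1, fun i j e => hc.1 (Subtype.ext e), fun i j => ?_⟩
      rw [← hc.2 i j, compl_adj', compl_adj', ctr_adj_of_ne (hx i) (hx j), Ne, Ne, Subtype.ext_iff]

lemma wc_color (n : ℕ) : ∀ (V : Type*) [Fintype V] (G : SimpleGraph V), Fintype.card V = n →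
    WeaklyChordal G → ∃ K : Finset V, (∀ u ∈ K, ∀ v ∈ K, u ≠ v → G.Adj u v) ∧
      ∃ f : V → Fin K.card, ∀ u v, G.Adj u v → f u ≠ f v := by
  classical
  induction n with
  | zero =>
    intro V _ G hV hG
    have := Fintype.card_eq_zero_iff.1 hV
    exact ⟨∅, by simp, fun v => isEmptyElim v, fun v => isEmptyElim v⟩
  | succ n ih =>
    intro V _ G hV hG
    by_cases hcl : ∃ a ∈ (Finset.univ : Finset V), ∃ b ∈ (Finset.univ : Finset V),
        a ≠ b ∧ ¬ G.Adj a b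
    · obtain ⟨x, y, h⟩ := exists_TP hG _ Finset.univ rfl hcl
      rw [Finset.coe_univ] at h
      obtain ⟨-, -, hxy, hnxy, -⟩ := id h
      have hcard : Fintype.card {v : V // v ≠ y} = n := by
        have := Fintype.card_subtype_compl (fun v : V => v = y)
        rw [Fintype.card_subtype_eq] at this
        simpa [hV] using this
      obtain ⟨K', hK', f', hf'⟩ := ih {v : V // v ≠ y} (Ctr G x y) hcard (ctr_wc hG h)
      have hmain : ∃ K : Finset V, K.card = K'.card ∧ ∀ u ∈ K, ∀ v ∈ K, u ≠ v → G.Adj u v := by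
        let L : Finset V := K'.map (Function.Embedding.subtype _)
        have hL : L.card = K'.card := Finset.card_map _
        have memL : ∀ v, v ∈ L ↔ ∃ hv : v ≠ y, (⟨v, hv⟩ : {v : V // v ≠ y}) ∈ K' := by
          intro v; simp [L]
        have hyL : y ∉ L := fun h => ((memL y).1 h).1 rfl
        have hLx : ∀ u ∈ L, ∀ v ∈ L, u ≠ x → v ≠ x → u ≠ v → G.Adj u v := by
          intro u hu v hv hux hvx huv
          obtain ⟨hu1, hu2⟩ := (memL u).1 hu
          obtain ⟨hv1, hv2⟩ := (memL v).1 hv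
          have := hK' _ hu2 _ hv2 (fun e => huv (congrArg Subtype.val e))
          rwa [ctr_adj_of_ne hux hvx] at this
        by_cases hxL : x ∈ L
        · have hor : ∀ v ∈ L, v ≠ x → G.Adj x v ∨ G.Adj y v := by
            intro v hv hvx
            obtain ⟨hu1, hu2⟩ := (memL x).1 hxL
            obtain ⟨hv1, hv2⟩ := (memL v).1 hv
            have := hK' _ hu2 _ hv2 (fun e => hvx (congrArg Subtype.val e).symm)
            exact (ctr_adj_left (u := ⟨x, hu1⟩) (v := ⟨v, hv1⟩) rfl hvx).1 this
          by_cases hallx : ∀ v ∈ L, v ≠ x → G.Adj x v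
          · refine ⟨L, hL, ?_⟩
            intro u hu v hv huv
            by_cases hux : u = x
            · subst hux; exact hallx v hv huv.symm
            · by_cases hvx : v = x
              · subst hvx; exact (hallx u hu huv).symm
              · exact hLx u hu v hv hux hvx huv
          · by_cases hally : ∀ v ∈ L, v ≠ x → G.Adj y v
            · refine ⟨insert y (L.erase x), ?_, ?_⟩
              · rw [Finset.card_insert_of_notMem (fun h => hyL (Finset.mem_of_mem_erase h)),
                  Finset.card_erase_add_one hxL, hL]
              · intro u hu v hv huv
                rcases Finset.mem_insert.1 hu with rfl | hu
                · rcases Finset.mem_insert.1 hv with rfl | hv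
                  · exact absurd rfl huv
                  · exact hally v (Finset.mem_of_mem_erase hv) (Finset.ne_of_mem_erase hv)
                · rcases Finset.mem_insert.1 hv with rfl | hv
                  · exact (hally u (Finset.mem_of_mem_erase hu) (Finset.ne_of_mem_erase hu)).symm
                  · exact hLx u (Finset.mem_of_mem_erase hu) v (Finset.mem_of_mem_erase hv)
                      (Finset.ne_of_mem_erase hu) (Finset.ne_of_mem_erase hv) huv
            · exfalso
              push Not at hallx hally
              obtain ⟨u, hu, hux, hu'⟩ := hallx
              obtain ⟨w, hw, hwx, hw'⟩ := hally
              have yu := (hor u hu hux).resolve_left hu'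
              have xw := (hor w hw hwx).resolve_right hw'
              have hwu : w ≠ u := by rintro rfl; exact hu' xw
              have hwy : w ≠ y := by rintro rfl; exact hyL hw
              exact h.no_path le_rfl (ip3 xw (hLx w hw u hu hwx hux hwu) yu.symm hux.symm hxy
                hwy hu' hnxy (fun h => hw' h.symm)) (by simp) (by simp)
        · refine ⟨L, hL, ?_⟩
          intro u hu v hv huv
          exact hLx u hu v hv (fun e => hxL (e ▸ hu)) (fun e => hxL (e ▸ hv)) huv
      obtain ⟨K, hKc, hK⟩ := hmain
      refine ⟨K, hK, ?_⟩
      rw [hKc]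
      refine ⟨fun v => if hv : v = y then f' ⟨x, hxy⟩ else f' ⟨v, hv⟩, ?_⟩
      intro u v huv
      by_cases hu : u = y
      · have hv : v ≠ y := by rintro rfl; exact huv.ne hu
        have hvx : v ≠ x := by rintro rfl; exact hnxy (hu ▸ huv).symm
        simp only [hu, hv, dif_pos, dif_neg, not_false_eq_true]
        exact hf' _ _ ((ctr_adj_left rfl hvx).2 (Or.inr (hu ▸ huv)))
      · by_cases hv : v = y
        · have hux : u ≠ x := by rintro rfl; exact hnxy (hv ▸ huv)
          simp only [hu, hv, dif_pos, dif_neg, not_false_eq_true]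
          exact (hf' _ _ ((ctr_adj_left rfl hux).2 (Or.inr (hv ▸ huv.symm)))).symm
        · simp only [hu, hv, dif_neg, not_false_eq_true]
          exact hf' _ _ ⟨fun e => huv.ne (congrArg Subtype.val e), Or.inl huv⟩
    · push Not at hcl
      refine ⟨Finset.univ, fun u hu v hv => hcl u hu v hv, Fintype.equivFin V, ?_⟩
      intro u v huv e
      exact huv.ne ((Fintype.equivFin V).injective e)

end helpers

/-- In a finite weakly chordal graph, the maximum size of an independent set equals the
minimum number of cliques needed to cover all vertices. -/
theorem weaklyChordal_indep_eq_cliqueCover {V : Type*} [Fintype V] (G : SimpleGraph V)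
    (hwc : WeaklyChordal G) :
    ∃ k : ℕ,
      IsGreatest {m | ∃ S : Finset V, S.card = m ∧
        (S : Set V).Pairwise fun u v => ¬ G.Adj u v} k ∧
      IsLeast {m | ∃ C : Fin m → Set V,
        (∀ i, G.IsClique (C i)) ∧ ∀ v : V, ∃ i, v ∈ C i} k := by
  classical
  have hc : WeaklyChordal Gᶜ := by
    refine ⟨hwc.2, ?_⟩
    rintro ⟨n, hn, c, h⟩
    rw [compl_compl] at h
    exact hwc.1 ⟨n, hn, c, h⟩
  obtain ⟨K, hK, f, hf⟩ := wc_color _ V Gᶜ rfl hc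
  have bound : ∀ (S : Finset V) (m : ℕ) (C : Fin m → Set V),
      ((S : Set V).Pairwise fun u v => ¬ G.Adj u v) → (∀ i, G.IsClique (C i)) →
      (∀ v : V, ∃ i, v ∈ C i) → S.card ≤ m := by
    intro S m C hS hC hcov
    choose g hg using hcov
    have := Finset.card_le_card_of_injOn (s := S) (t := (Finset.univ : Finset (Fin m))) g
      (by simp) (by
        intro u hu v hv e
        by_contra huv
        exact hS hu hv huv (hC (g u) (hg u) (e ▸ hg v) huv))
    simpa using this
  have hKi : (K : Set V).Pairwise fun u v => ¬ G.Adj u v := fun u hu v hv huv =>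
    (compl_adj'.1 (hK u hu v hv huv)).2
  have hcl : ∀ i, G.IsClique {v | f v = i} := by
    intro i u hu v hv huv
    by_contra hn
    exact hf u v (compl_adj'.2 ⟨huv, hn⟩) (Eq.trans hu (Eq.symm hv))
  refine ⟨K.card, ⟨⟨K, rfl, hKi⟩, ?_⟩, ⟨⟨fun i => {v | f v = i}, hcl, fun v => ⟨f v, rfl⟩⟩, ?_⟩⟩
  · rintro m ⟨S, rfl, hS⟩
    exact bound S _ _ hS hcl (fun v => ⟨f v, rfl⟩)
  · rintro m ⟨C, hC, hcov⟩
    exact bound K m C hKi hC hcov
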